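/- If u_0 is a continuous function on the closure of D, then the function (x,t) ↦ G_t u_0(x) (with G_0 u_0 = u_0) is continuous on closure(D) × [0,T] for every T > 0. -/

import Mathlib

open MeasureTheory Real Set

noncomputable section

/-- The spatial domain `D = (0,π)^d` as a subset of Euclidean space. -/
def domD (d : ℕ) : Set (EuclideanSpace ℝ (Fin d)) :=
  {x | ∀ i, x i ∈ Set.Ioo (0 : ℝ) π}

/-- One-dimensional normalized cosine functions: `ε_0 = 1/√π`, `ε_j(x) = √(2/π) cos(jx)`. -/
def eps1 (j : ℕ) (x : ℝ) : ℝ :=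
  if j = 0 then 1 / Real.sqrt π else Real.sqrt (2 / π) * Real.cos (j * x)

/-- The product functions `ε_k(x) = ∏ i, ε_{k i}(x i)` for a multi-index `k ∈ ℕ^d`. -/
def epsk {d : ℕ} (k : Fin d → ℕ) (x : EuclideanSpace ℝ (Fin d)) : ℝ :=
  ∏ i, eps1 (k i) (x i)

/-- The eigenvalue `λ_k = ∑ i, k_i²`. -/
def lam {d : ℕ} (k : Fin d → ℕ) : ℝ := ∑ i, (k i : ℝ) ^ 2

/-- The Green's function of `−Δ²+Δ` with homogeneous Neumann boundary conditions on `D`: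
`G(x,y,t) = ∑_{k∈ℕ^d} e^{−(λ_k²+λ_k)t} ε_k(x) ε_k(y)`. -/
def green {d : ℕ} (x y : EuclideanSpace ℝ (Fin d)) (t : ℝ) : ℝ :=
  ∑' k : Fin d → ℕ, Real.exp (-(lam k ^ 2 + lam k) * t) * epsk k x * epsk k y

/-- The action of the convolution semigroup on an initial condition:
`G_t u₀(x) = ∫_D u₀(y) G(x,y,t) dy` for `t > 0`, and `G_0 u₀ = u₀`. -/
def greenSemigroup {d : ℕ} (u₀ : EuclideanSpace ℝ (Fin d) → ℝ) (t : ℝ)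
    (x : EuclideanSpace ℝ (Fin d)) : ℝ :=
  if t = 0 then u₀ x else ∫ y in domD d, u₀ y * green x y t


theorem gs_prod_sum {d : ℕ} (a : Fin d → ℕ → ℂ) (ha : ∀ i, Summable fun n => ‖a i n‖) :
    (Summable fun k : Fin d → ℕ => ‖∏ i, a i (k i)‖) ∧
      ∑' k : Fin d → ℕ, ∏ i, a i (k i) = ∏ i, ∑' n, a i n := by
  induction d with
  | zero =>
    constructor
    · exact (hasSum_fintype _).summable
    · rw [tsum_fintype]; simp
  | succ d ih =>
    obtain ⟨h1, h2⟩ := ih (fun i => a i.succ) (fun i => ha i.succ)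
    have e := (Fin.consEquiv (fun _ : Fin (d + 1) => ℕ))
    have key : ∀ p : ℕ × (Fin d → ℕ),
        ∏ i, a i ((Fin.consEquiv (fun _ : Fin (d + 1) => ℕ)) p i)
          = a 0 p.1 * ∏ i, a i.succ (p.2 i) := by
      intro p
      rw [Fin.prod_univ_succ]
      simp [Fin.consEquiv]
    constructor
    · rw [← (Fin.consEquiv (fun _ : Fin (d + 1) => ℕ)).summable_iff]
      have := Summable.mul_norm (ha 0) h1
      refine this.congr ?_
      intro p
      simp only [Function.comp]
      rw [key]
    · rw [← (Fin.consEquiv (fun _ : Fin (d + 1) => ℕ)).tsum_eq, Fin.prod_univ_succ, ← h2,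
        tsum_mul_tsum_of_summable_norm (ha 0) h1]
      exact tsum_congr key

theorem gs_summable_int (z : ℂ) (hz : 0 < z.re) (w : ℝ) :
    Summable fun n : ℤ => Complex.exp (-z * (n : ℂ) ^ 2 + Complex.I * w * n) := by
  have h := (summable_jacobiTheta₂_term_iff (w / (2 * π)) (Complex.I * z / π)).2 (by
    have : (Complex.I * z / π).im = z.re / π := by
      rw [Complex.div_ofReal_im]; simp
    rw [this]; positivity)
  refine h.congr fun n => ?_
  have hpi : (π : ℂ) ≠ 0 := by exact_mod_cast Real.pi_ne_zero
  unfold jacobiTheta₂_term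
  congr 1
  field_simp
  ring_nf
  simp only [Complex.I_sq]
  ring

/-- periodic theta function -/
def gsTheta (z : ℂ) (w : ℝ) : ℂ := ∑' n : ℤ, Complex.exp (-z * (n : ℂ) ^ 2 + Complex.I * w * n)

/-- Gaussian side of the theta function -/
def gsGauss (b w : ℝ) : ℝ := ∑' n : ℤ, Real.exp (-(π ^ 2 * b) * ((n : ℝ) - w / (2 * π)) ^ 2)

theorem gs_summable_gauss (b w : ℝ) (hb : 0 < b) :
    Summable fun n : ℤ => Real.exp (-(π ^ 2 * b) * ((n : ℝ) - w / (2 * π)) ^ 2) := by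
  have h := (summable_jacobiTheta₂_term_iff (-Complex.I * ((π * b * (w / (2 * π)) : ℝ) : ℂ))
    (Complex.I * (π * b))).2 (by simp; positivity)
  have h2 := (h.norm).mul_left (Real.exp (-(π ^ 2 * b) * (w / (2 * π)) ^ 2))
  refine h2.congr fun n => ?_
  rw [norm_jacobiTheta₂_term, ← Real.exp_add]
  congr 1
  rw [neg_mul Complex.I, Complex.neg_im, Complex.I_mul_im, Complex.I_mul_im, Complex.ofReal_re]
  simp
  field_simp
  ring

theorem gs_theta_eq (z : ℂ) (hz : 0 < z.re) (w : ℝ) :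
    gsTheta z w = 1 / (z / π) ^ (1 / 2 : ℂ) *
      ∑' n : ℤ, Complex.exp (-(π ^ 2 / z) * ((n : ℂ) - w / (2 * π)) ^ 2) := by
  have hpi : (π : ℂ) ≠ 0 := by exact_mod_cast Real.pi_ne_zero
  have hz0 : z ≠ 0 := by rintro rfl; simp at hz
  have h := Complex.tsum_exp_neg_quadratic (a := z / π)
    (by rw [Complex.div_ofReal_re]; positivity) (Complex.I * w / (2 * π))
  unfold gsTheta
  convert h using 1
  · refine tsum_congr fun n => ?_
    congr 1
    field_simp
  · congr 1
    refine tsum_congr fun n => ?_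
    congr 1
    have : Complex.I * (Complex.I * (w : ℂ) / (2 * π)) = - (w / (2 * π)) := by
      rw [← mul_div_assoc, ← mul_assoc, Complex.I_mul_I]; ring
    rw [this]
    field_simp
    ring

theorem gs_theta_real (τ : ℝ) (hτ : 0 < τ) (w : ℝ) :
    gsTheta τ w = ((1 / (τ / π) ^ (1 / 2 : ℝ) * gsGauss (1 / τ) w : ℝ) : ℂ) := by
  rw [gs_theta_eq _ (by simpa using hτ), gsGauss]
  push_cast
  rw [Complex.ofReal_cpow (by positivity)]
  push_cast
  congr 1
  refine tsum_congr fun n => ?_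
  congr 2
  ring

theorem gs_theta_norm (z : ℂ) (hz : 0 < z.re) (w : ℝ) :
    ‖gsTheta z w‖ ≤ 1 / (‖z‖ / π) ^ (1 / 2 : ℝ) * gsGauss (z⁻¹.re) w := by
  have hz0 : z ≠ 0 := by rintro rfl; simp at hz
  have hre : 0 < z⁻¹.re := by
    rw [Complex.inv_re]; exact div_pos hz (Complex.normSq_pos.2 hz0)
  rw [gs_theta_eq _ hz, norm_mul]
  have h1 : ‖1 / (z / π) ^ (1 / 2 : ℂ)‖ = 1 / (‖z‖ / π) ^ (1 / 2 : ℝ) := by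
    have := Complex.norm_cpow_real (z / π) (1 / 2)
    push_cast at this
    rw [norm_div, norm_one, this, norm_div, Complex.norm_real, Real.norm_of_nonneg Real.pi_pos.le]
  rw [h1]
  refine mul_le_mul_of_nonneg_left ?_ (by positivity)
  refine tsum_of_norm_bounded (gs_summable_gauss _ w hre).hasSum fun n => ?_
  rw [Complex.norm_exp]
  have : (-(π ^ 2 / z) * ((n : ℂ) - w / (2 * π)) ^ 2)
      = ((-(π ^ 2) * ((n : ℝ) - w / (2 * π)) ^ 2 : ℝ) : ℂ) * z⁻¹ := by
    push_cast
    rw [div_eq_mul_inv]; ring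
  rw [this, Complex.re_ofReal_mul]
  apply le_of_eq
  congr 1
  ring

/-- the real time dominating the complex time -/
def gsTau (z : ℂ) : ℝ := 1 / z⁻¹.re

theorem gs_tau_pos (z : ℂ) (hz : 0 < z.re) : 0 < gsTau z := by
  have hz0 : z ≠ 0 := by rintro rfl; simp at hz
  have hre : 0 < z⁻¹.re := by
    rw [Complex.inv_re]; exact div_pos hz (Complex.normSq_pos.2 hz0)
  exact one_div_pos.2 hre

/-- real theta -/
def gsThetaR (τ w : ℝ) : ℝ := (gsTheta τ w).re

theorem gs_thetaR (τ : ℝ) (hτ : 0 < τ) (w : ℝ) : gsTheta τ w = (gsThetaR τ w : ℂ) := by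
  rw [gsThetaR, gs_theta_real τ hτ w, Complex.ofReal_re]

theorem gs_theta_dom (z : ℂ) (hz : 0 < z.re) (hz3 : ‖z‖ ≤ 3 * z.re) (w : ℝ) :
    ‖gsTheta z w‖ ≤ 3 * gsThetaR (gsTau z) w := by
  have hz0 : z ≠ 0 := by rintro rfl; simp at hz
  have hn : 0 < ‖z‖ := norm_pos_iff.2 hz0
  refine (gs_theta_norm z hz w).trans ?_
  rw [gsThetaR, gs_theta_real _ (gs_tau_pos z hz), Complex.ofReal_re]
  have hτ := gs_tau_pos z hz
  have : 1 / gsTau z = z⁻¹.re := by simp [gsTau]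
  rw [this, ← mul_assoc]
  refine mul_le_mul_of_nonneg_right ?_ (tsum_nonneg fun n => (Real.exp_pos _).le)
  rw [mul_one_div, div_le_div_iff₀ (by positivity) (by positivity), one_mul,
    ← Real.sqrt_eq_rpow, ← Real.sqrt_eq_rpow]
  have h9 : (3 : ℝ) = Real.sqrt 9 := by
    rw [show (9 : ℝ) = 3 ^ 2 by norm_num, Real.sqrt_sq (by norm_num)]
  rw [h9, ← Real.sqrt_mul (by norm_num)]
  apply Real.sqrt_le_sqrt
  rw [← mul_div_assoc]
  refine div_le_div_of_nonneg_right ?_ Real.pi_pos.le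
  rw [gsTau, Complex.inv_re, one_div_div, Complex.normSq_eq_norm_sq, div_le_iff₀ hz]
  nlinarith

theorem gs_eps1_abs (n : ℕ) (x : ℝ) : |eps1 n x| ≤ 1 := by
  have hpi := Real.pi_gt_three
  unfold eps1
  split_ifs with h
  · rw [abs_of_nonneg (by positivity), div_le_one (by positivity)]
    rw [Real.one_le_sqrt]; linarith
  · rw [abs_mul, abs_of_nonneg (Real.sqrt_nonneg _)]
    refine mul_le_one₀ ?_ (abs_nonneg _) (Real.abs_cos_le_one _)
    rw [Real.sqrt_le_iff]
    refine ⟨by norm_num, ?_⟩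
    rw [one_pow, div_le_one (by positivity)]; linarith

theorem gs_summable_nat (r : ℝ) (hr : 0 < r) :
    Summable fun n : ℕ => Real.exp (-r * (n : ℝ) ^ 2) := by
  have h := ((gs_summable_int r (by simpa using hr) 0).norm).comp_injective
    (Nat.cast_injective (R := ℤ))
  refine h.congr fun n => ?_
  simp only [Function.comp, Complex.norm_exp]
  congr 1
  have : (-(r : ℂ) * (((n : ℕ) : ℤ) : ℂ) ^ 2 + Complex.I * ((0 : ℝ) : ℂ) * (((n : ℕ) : ℤ) : ℂ))
    = ((-r * (n : ℝ) ^ 2 : ℝ) : ℂ) := by push_cast; ring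
  rw [this, Complex.ofReal_re]

/-- 1D terms -/
def gsTerm (z : ℂ) (x y : ℝ) (n : ℕ) : ℂ :=
  Complex.exp (-z * (n : ℂ) ^ 2) * ((eps1 n x * eps1 n y : ℝ) : ℂ)

theorem gs_norm_exp (z : ℂ) (n : ℕ) :
    ‖Complex.exp (-z * (n : ℂ) ^ 2)‖ = Real.exp (-z.re * (n : ℝ) ^ 2) := by
  rw [Complex.norm_exp]
  congr 1
  have : -z * (n : ℂ) ^ 2 = (((n : ℝ) ^ 2 : ℝ) : ℂ) * (-z) := by push_cast; ring
  rw [this, Complex.re_ofReal_mul, Complex.neg_re]; ring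

theorem gs_summable_term (z : ℂ) (hz : 0 < z.re) (x y : ℝ) :
    Summable fun n => ‖gsTerm z x y n‖ := by
  refine Summable.of_nonneg_of_le (fun _ => norm_nonneg _) (fun n => ?_)
    (gs_summable_nat z.re hz)
  rw [gsTerm, norm_mul, gs_norm_exp, Complex.norm_real, Real.norm_eq_abs, abs_mul]
  refine mul_le_of_le_one_right (Real.exp_pos _).le ?_
  exact mul_le_one₀ (gs_eps1_abs _ _) (abs_nonneg _) (gs_eps1_abs _ _)

/-- 1D complex-time heat kernel -/
def gsH1 (z : ℂ) (x y : ℝ) : ℂ := ∑' n, gsTerm z x y n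

theorem gs_theta_hasSum (z : ℂ) (hz : 0 < z.re) (w : ℝ) :
    HasSum (fun n : ℕ => 2 * Complex.exp (-z * (n : ℂ) ^ 2) * Complex.cos (n * w))
      (gsTheta z w + 1) := by
  have h := ((gs_summable_int z hz w).hasSum).nat_add_neg
  convert h using 1
  · ext n
    rw [Complex.cos]
    have e1 : -z * (((n : ℕ) : ℤ) : ℂ) ^ 2 + Complex.I * w * (((n : ℕ) : ℤ) : ℂ)
      = -z * (n : ℂ) ^ 2 + (n * w) * Complex.I := by push_cast; ring
    have e2 : -z * ((-((n : ℕ) : ℤ) : ℤ) : ℂ) ^ 2 + Complex.I * w * ((-((n : ℕ) : ℤ) : ℤ) : ℂ)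
      = -z * (n : ℂ) ^ 2 + -(n * w) * Complex.I := by push_cast; ring
    rw [e1, e2, Complex.exp_add, Complex.exp_add]
    ring
  · simp [gsTheta]

theorem gs_H1_eq (z : ℂ) (hz : 0 < z.re) (x y : ℝ) :
    gsH1 z x y = (1 / (2 * π) : ℝ) * (gsTheta z (x - y) + gsTheta z (x + y)) := by
  have h := ((gs_theta_hasSum z hz (x - y)).add (gs_theta_hasSum z hz (x + y))).sub
    (hasSum_ite_eq (0 : ℕ) (2 : ℂ))
  have h2 := (h.mul_left ((1 / (2 * π) : ℝ) : ℂ)).tsum_eq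
  have e : gsTheta z (x - y) + gsTheta z (x + y)
    = gsTheta z (x - y) + 1 + (gsTheta z (x + y) + 1) - 2 := by ring
  rw [e, ← h2, gsH1]
  refine tsum_congr fun n => ?_
  have hpi : (π : ℂ) ≠ 0 := by exact_mod_cast Real.pi_ne_zero
  by_cases hn : n = 0
  · subst hn
    have : (1 / Real.sqrt π) * (1 / Real.sqrt π) = 1 / π := by
      rw [div_mul_div_comm, Real.mul_self_sqrt Real.pi_pos.le, one_mul]
    simp only [gsTerm, eps1, if_true, this]
    simp
  · have : (Real.sqrt (2 / π) * Real.cos (n * x)) * (Real.sqrt (2 / π) * Real.cos (n * y))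
      = 2 / π * (Real.cos (n * x) * Real.cos (n * y)) := by
      rw [mul_mul_mul_comm, Real.mul_self_sqrt (by positivity)]
    simp only [gsTerm, eps1, if_neg hn, this]
    push_cast
    rw [mul_sub (n : ℂ), mul_add (n : ℂ), Complex.cos_sub, Complex.cos_add]
    field_simp
    ring

/-- 1D real-time heat kernel -/
def gsH1R (τ x y : ℝ) : ℝ := ∑' n : ℕ, Real.exp (-τ * (n : ℝ) ^ 2) * (eps1 n x * eps1 n y)

theorem gs_H1R (τ x y : ℝ) : gsH1 τ x y = (gsH1R τ x y : ℂ) := by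
  rw [gsH1R, Complex.ofReal_tsum, gsH1]
  refine tsum_congr fun n => ?_
  rw [gsTerm]; push_cast; rfl

theorem gs_H1_dom (z : ℂ) (hz : 0 < z.re) (hz3 : ‖z‖ ≤ 3 * z.re) (x y : ℝ) :
    ‖gsH1 z x y‖ ≤ 3 * gsH1R (gsTau z) x y := by
  have hτ := gs_tau_pos z hz
  have e : gsH1R (gsTau z) x y
      = 1 / (2 * π) * (gsThetaR (gsTau z) (x - y) + gsThetaR (gsTau z) (x + y)) := by
    have h1 := gs_H1_eq (gsTau z) (by simpa using hτ) x y
    rw [gs_H1R, gs_thetaR _ hτ, gs_thetaR _ hτ] at h1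
    exact_mod_cast h1
  rw [e, gs_H1_eq z hz, norm_mul, Complex.norm_real, Real.norm_of_nonneg (by positivity),
    mul_left_comm]
  refine mul_le_mul_of_nonneg_left ?_ (by positivity)
  refine (norm_add_le _ _).trans ?_
  have := gs_theta_dom z hz hz3 (x - y)
  have := gs_theta_dom z hz hz3 (x + y)
  linarith

/-- multi-dimensional terms: summability and product formula -/
theorem gs_lam_exp {d : ℕ} (z : ℂ) (k : Fin d → ℕ) :
    Complex.exp (-z * (lam k : ℂ)) = ∏ i, Complex.exp (-z * (k i : ℂ) ^ 2) := by
  rw [← Complex.exp_sum, ← Finset.mul_sum, lam]; push_cast; rfl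

theorem gs_term_prod {d : ℕ} (z : ℂ) (x y : EuclideanSpace ℝ (Fin d)) (k : Fin d → ℕ) :
    ∏ i, gsTerm z (x i) (y i) (k i) = (epsk k x * epsk k y) • Complex.exp (-z * (lam k : ℂ)) := by
  simp only [gsTerm, Finset.prod_mul_distrib, gs_lam_exp, epsk, Complex.real_smul]
  push_cast
  rw [Finset.prod_mul_distrib]
  ring

theorem gs_summable_lam {d : ℕ} (z : ℂ) (hz : 0 < z.re) :
    Summable fun k : Fin d → ℕ => ‖Complex.exp (-z * (lam k : ℂ))‖ := by
  have := (gs_prod_sum (d := d) (fun _ n => Complex.exp (-z * (n : ℂ) ^ 2)) (fun i => by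
    simp only [gs_norm_exp]; exact gs_summable_nat _ hz)).1
  refine this.congr fun k => ?_
  rw [gs_lam_exp]

/-- heat kernel, real time -/
def gsHR {d : ℕ} (τ : ℝ) (x y : EuclideanSpace ℝ (Fin d)) : ℝ :=
  ∑' k : Fin d → ℕ, (epsk k x * epsk k y) • Real.exp (-τ * lam k)

/-- heat kernel, complex time -/
def gsH {d : ℕ} (z : ℂ) (x y : EuclideanSpace ℝ (Fin d)) : ℂ :=
  ∑' k : Fin d → ℕ, (epsk k x * epsk k y) • Complex.exp (-z * (lam k : ℂ))

theorem gs_H_prod {d : ℕ} (z : ℂ) (hz : 0 < z.re) (x y : EuclideanSpace ℝ (Fin d)) :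
    gsH z x y = ∏ i, gsH1 z (x i) (y i) := by
  simp only [gsH, ← gs_term_prod]
  exact (gs_prod_sum (fun i => gsTerm z (x i) (y i))
    (fun i => gs_summable_term z hz (x i) (y i))).2

theorem gs_HR {d : ℕ} (τ : ℝ) (x y : EuclideanSpace ℝ (Fin d)) :
    gsH τ x y = (gsHR τ x y : ℂ) := by
  rw [gsHR, Complex.ofReal_tsum, gsH]
  refine tsum_congr fun n => ?_
  simp

theorem gs_H_dom {d : ℕ} (z : ℂ) (hz : 0 < z.re) (hz3 : ‖z‖ ≤ 3 * z.re)
    (x y : EuclideanSpace ℝ (Fin d)) :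
    ‖gsH z x y‖ ≤ 3 ^ d * gsHR (gsTau z) x y := by
  have hτ := gs_tau_pos z hz
  have e : gsHR (gsTau z) x y = ∏ i, gsH1R (gsTau z) (x i) (y i) := by
    have h1 := gs_H_prod (gsTau z) (by simpa using hτ) x y
    simp only [gs_HR, gs_H1R] at h1
    exact_mod_cast h1
  rw [gs_H_prod z hz, norm_prod, e]
  calc ∏ i, ‖gsH1 z (x i) (y i)‖ ≤ ∏ i : Fin d, (3 * gsH1R (gsTau z) (x i) (y i)) :=
        Finset.prod_le_prod (fun _ _ => norm_nonneg _) fun i _ => gs_H1_dom z hz hz3 _ _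
    _ = _ := by rw [Finset.prod_mul_distrib]; simp

/-- direction of the ray -/
def gsω : ℂ := 1 + 2 * Complex.I

theorem gs_ω_sq : gsω ^ 2 = -3 + 4 * Complex.I := by
  unfold gsω
  ring_nf
  rw [Complex.I_sq]; ring

/-- integrand -/
def gsE (l s : ℝ) : ℂ := Complex.exp (gsω ^ 2 * (s : ℂ) ^ 2 - l * gsω * s)

theorem gs_normE (l s : ℝ) : ‖gsE l s‖ = Real.exp (-3 * s ^ 2 - l * s) := by
  rw [gsE, Complex.norm_exp]
  congr 1
  rw [gs_ω_sq, gsω]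
  have : (-3 + 4 * Complex.I) * (s : ℂ) ^ 2 - l * (1 + 2 * Complex.I) * s
    = ((-3 * s ^ 2 - l * s : ℝ) : ℂ) + ((4 * s ^ 2 - 2 * l * s : ℝ) : ℂ) * Complex.I := by
    push_cast; ring
  rw [this]; simp only [Complex.add_re, Complex.ofReal_re, Complex.re_ofReal_mul, Complex.I_re,
    mul_zero, add_zero]

theorem gs_bound (b : ℝ) (s : ℝ) :
    Real.exp (-3 * s ^ 2 + b * s) ≤ Real.exp (b ^ 2 / 4) * Real.exp (-2 * s ^ 2) := by
  rw [← Real.exp_add]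
  apply Real.exp_le_exp.2
  nlinarith [sq_nonneg (s - b / 2)]

theorem gs_contE (l : ℝ) : Continuous (gsE l) := by
  unfold gsE; fun_prop

theorem gs_intE (l : ℝ) : Integrable (gsE l) := by
  refine Integrable.mono' ((integrable_exp_neg_mul_sq (b := 2) (by norm_num)).const_mul
    (Real.exp ((-l) ^ 2 / 4))) (gs_contE l).aestronglyMeasurable (Filter.Eventually.of_forall ?_)
  intro s
  rw [gs_normE]
  have := gs_bound (-l) s
  convert this using 2
  ring

/-- ray integral -/
def gsI (l : ℝ) : ℂ := ∫ s in Set.Ioi (0 : ℝ), gsω * gsE l s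

theorem gs_bound2 (b s : ℝ) (hs : 0 ≤ s) :
    s * Real.exp (-3 * s ^ 2 + b * s) ≤
      Real.exp ((b + 1) ^ 2 / 4) * Real.exp (-2 * s ^ 2) := by
  refine le_trans ?_ (gs_bound (b + 1) s)
  have : Real.exp (-3 * s ^ 2 + (b + 1) * s) = Real.exp s * Real.exp (-3 * s ^ 2 + b * s) := by
    rw [← Real.exp_add]; congr 1; ring
  rw [this]
  refine mul_le_mul_of_nonneg_right ?_ (Real.exp_pos _).le
  linarith [Real.add_one_le_exp s]

theorem gs_I_deriv (l : ℝ) :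
    IntegrableOn (fun s : ℝ => gsω * (gsE l s * (-gsω * s))) (Set.Ioi 0) ∧
    HasDerivAt gsI (∫ s in Set.Ioi (0 : ℝ), gsω * (gsE l s * (-gsω * s))) l := by
  refine hasDerivAt_integral_of_dominated_loc_of_deriv_le (𝕜 := ℝ)
    (F := fun l s => gsω * gsE l s) (F' := fun l s => gsω * (gsE l s * (-gsω * s)))
    (bound := fun s => ‖gsω‖ * ‖gsω‖ *
      (Real.exp ((|l| + 1 + 1) ^ 2 / 4) * Real.exp (-2 * s ^ 2)))
    (Metric.ball_mem_nhds l one_pos) ?_ ?_ ?_ ?_ ?_ ?_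
  · exact Filter.Eventually.of_forall fun l =>
      ((gs_contE l).const_mul gsω).aestronglyMeasurable
  · exact ((gs_intE l).const_mul gsω).integrableOn
  · have := gs_contE l
    exact Continuous.aestronglyMeasurable (by fun_prop)
  · filter_upwards [ae_restrict_mem measurableSet_Ioi] with s hs m hm
    have hs0 : (0 : ℝ) < s := hs
    rw [norm_mul, norm_mul, norm_mul, norm_neg, Complex.norm_real, Real.norm_of_nonneg hs0.le,
      gs_normE]
    have hml : |m| ≤ |l| + 1 := by
      have h1 : |m - l| < 1 := by simpa [Real.dist_eq] using hm
      have h2 := abs_sub_abs_le_abs_sub m l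
      linarith
    have h1 : Real.exp (-3 * s ^ 2 - m * s) ≤ Real.exp (-3 * s ^ 2 + (|l| + 1) * s) := by
      apply Real.exp_le_exp.2
      nlinarith [neg_abs_le m]
    have h2 := gs_bound2 (|l| + 1) s hs0.le
    calc ‖gsω‖ * (Real.exp (-3 * s ^ 2 - m * s) * (‖gsω‖ * s))
        = ‖gsω‖ * ‖gsω‖ * (s * Real.exp (-3 * s ^ 2 - m * s)) := by ring
      _ ≤ _ := by
        refine mul_le_mul_of_nonneg_left (le_trans ?_ h2) (by positivity)
        exact mul_le_mul_of_nonneg_left h1 hs0.le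
  · exact (((integrable_exp_neg_mul_sq (b := 2) (by norm_num)).const_mul _).const_mul
      _).integrableOn
  · filter_upwards with s m _
    have h1 : HasDerivAt (fun m : ℝ => gsω ^ 2 * (s : ℂ) ^ 2 - (m : ℂ) * gsω * s)
        (-gsω * s) m := by
      have h0 : HasDerivAt (fun m : ℝ => (m : ℂ)) 1 m := Complex.ofRealCLM.hasDerivAt
      have := ((h0.mul_const gsω).mul_const (s : ℂ)).const_sub (gsω ^ 2 * (s : ℂ) ^ 2)
      exact this.congr_deriv (by ring)
    exact (h1.cexp).const_mul gsω

theorem gs_I_ode (l : ℝ) :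
    ∫ s in Set.Ioi (0 : ℝ), gsω * (gsE l s * (-gsω * s)) = 1 / 2 - l / 2 * gsI l := by
  have hd : ∀ s ∈ Set.Ici (0 : ℝ), HasDerivAt (gsE l)
      (gsE l s * (gsω ^ 2 * (2 * s) - l * gsω)) s := by
    intro s _
    have h0 : HasDerivAt (fun m : ℝ => (m : ℂ)) 1 s := Complex.ofRealCLM.hasDerivAt
    have h1 : HasDerivAt (fun s : ℝ => gsω ^ 2 * (s : ℂ) ^ 2 - (l : ℂ) * gsω * s)
        (gsω ^ 2 * (2 * s) - l * gsω) s := by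
      have := ((h0.pow 2).const_mul (gsω ^ 2)).sub (h0.const_mul ((l : ℂ) * gsω))
      exact this.congr_deriv (by simp)
    exact h1.cexp
  have e : ∀ s : ℝ, gsE l s * (gsω ^ 2 * (2 * s) - l * gsω)
      = (-2 : ℂ) * (gsω * (gsE l s * (-gsω * s))) - l * (gsω * gsE l s) := by intro s; ring
  have i1 := (gs_I_deriv l).1.const_mul (-2 : ℂ)
  have i2 : IntegrableOn (fun s => (l : ℂ) * (gsω * gsE l s)) (Set.Ioi 0) :=
    (((gs_intE l).const_mul gsω).const_mul (l : ℂ)).integrableOn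
  have ht : Filter.Tendsto (gsE l) Filter.atTop (nhds 0) := by
    rw [tendsto_zero_iff_norm_tendsto_zero]
    have hb : Filter.Tendsto (fun s : ℝ => Real.exp ((-l) ^ 2 / 4) * Real.exp (-2 * s ^ 2))
        Filter.atTop (nhds 0) := by
      rw [← mul_zero (Real.exp ((-l) ^ 2 / 4))]
      refine Filter.Tendsto.const_mul _ (Real.tendsto_exp_atBot.comp ?_)
      exact (Filter.tendsto_pow_atTop (by norm_num)).const_mul_atTop_of_neg (by norm_num)
    refine squeeze_zero (fun _ => norm_nonneg _) (fun s => ?_) hb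
    rw [gs_normE]
    have := gs_bound (-l) s
    convert this using 2
    ring
  have h := integral_Ioi_of_hasDerivAt_of_tendsto' hd (by
    simp only [e]; exact i1.sub i2) ht
  simp only [e] at h
  rw [integral_sub i1 i2, integral_const_mul (-2 : ℂ), integral_const_mul (l : ℂ)] at h
  have h0 : gsE l 0 = 1 := by simp [gsE]
  rw [h0] at h
  change _ - (l : ℂ) * gsI l = _ at h
  linear_combination (-1 / 2 : ℂ) * h

theorem gs_I_im (l : ℝ) : (gsI l).im = (gsI 0).im * Real.exp (-l ^ 2 / 4) := by
  have hd : ∀ l, HasDerivAt (fun l => (gsI l).im) (-(l / 2) * (gsI l).im) l := by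
    intro l
    have h := (gs_I_deriv l).2
    rw [gs_I_ode] at h
    have h2 := (Complex.imCLM.hasFDerivAt.comp_hasDerivAt l h)
    refine h2.congr_deriv ?_
    have : (1 / 2 - (l : ℂ) / 2 * gsI l) = ((1 / 2 : ℝ) : ℂ) - ((l / 2 : ℝ) : ℂ) * gsI l := by
      push_cast; ring
    rw [this, Complex.imCLM_apply, Complex.sub_im, Complex.im_ofReal_mul, Complex.ofReal_im]
    ring
  have hd2 : ∀ l, HasDerivAt (fun l => (gsI l).im * Real.exp (l ^ 2 / 4)) 0 l := by
    intro l
    have h1 : HasDerivAt (fun l : ℝ => Real.exp (l ^ 2 / 4)) (Real.exp (l ^ 2 / 4) * (l / 2)) l := by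
      have := (((hasDerivAt_id l).pow 2).div_const 4).exp
      exact this.congr_deriv (by simp; ring)
    have := (hd l).mul h1
    exact this.congr_deriv (by ring)
  have hc := is_const_of_deriv_eq_zero (fun l => (hd2 l).differentiableAt)
    (fun l => (hd2 l).deriv) l 0
  have h0 : Real.exp ((0 : ℝ) ^ 2 / 4) = 1 := by simp
  rw [h0, mul_one] at hc
  rw [← hc, mul_assoc, ← Real.exp_add]
  have : l ^ 2 / 4 + -l ^ 2 / 4 = 0 := by ring
  rw [this, Real.exp_zero, mul_one]

theorem gs_I_ne : (gsI 0).im ≠ 0 := by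
  intro h
  have hsq : gsI 0 ^ 2 = -((π / 4 : ℝ) : ℂ) := by
    have h1 : gsI 0 = gsω * ((π / (-gsω ^ 2)) ^ (1 / 2 : ℂ) / 2) := by
      rw [gsI, integral_const_mul, ← integral_gaussian_complex_Ioi]
      · congr 1
        refine integral_congr_ae (Filter.Eventually.of_forall fun s => ?_)
        simp [gsE]
      · rw [gs_ω_sq]; simp
    have hne : gsω ≠ 0 := by
      intro h; have := congrArg Complex.re h; simp [gsω] at this
    have h2 : ((π / (-gsω ^ 2)) ^ (1 / 2 : ℂ)) ^ 2 = π / (-gsω ^ 2) := by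
      rw [← Complex.cpow_nat_mul]; norm_num
    rw [h1, mul_pow, div_pow, h2]
    push_cast
    field_simp
    norm_num
  have hre : gsI 0 = ((gsI 0).re : ℂ) := by
    apply Complex.ext <;> simp [h]
  rw [hre] at hsq
  have : (gsI 0).re ^ 2 = -(π / 4) := by exact_mod_cast hsq
  nlinarith [sq_nonneg (gsI 0).re, Real.pi_pos]

theorem gs_int_cos (m : ℤ) :
    ∫ x in (0 : ℝ)..π, Real.cos (m * x) = if m = 0 then π else 0 := by
  split_ifs with h
  · subst h; simp
  · have hm : (m : ℝ) ≠ 0 := by exact_mod_cast h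
    rw [intervalIntegral.integral_comp_mul_left _ hm, integral_cos]
    simp [Real.sin_int_mul_pi]

theorem gs_int_coscos (j k : ℕ) :
    ∫ x in (0 : ℝ)..π, Real.cos (j * x) * Real.cos (k * x) =
      ((if (j : ℤ) - k = 0 then π else 0) + (if (j : ℤ) + k = 0 then π else 0)) / 2 := by
  rw [← gs_int_cos, ← gs_int_cos, ← intervalIntegral.integral_add, ← intervalIntegral.integral_div]
  · refine intervalIntegral.integral_congr fun x _ => ?_
    push_cast
    rw [sub_mul, add_mul, Real.cos_sub, Real.cos_add]
    ring
  · exact (by fun_prop : Continuous fun x : ℝ => Real.cos (((j : ℤ) - k : ℤ) * x)).intervalIntegrable _ _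
  · exact (by fun_prop : Continuous fun x : ℝ => Real.cos (((j : ℤ) + k : ℤ) * x)).intervalIntegrable _ _

theorem gs_eps1_eq (j : ℕ) (x : ℝ) :
    eps1 j x = (if j = 0 then 1 / Real.sqrt π else Real.sqrt (2 / π)) * Real.cos (j * x) := by
  unfold eps1
  split_ifs with h
  · subst h; simp
  · rfl

theorem gs_orth1 (j k : ℕ) :
    ∫ x in Set.Ioo (0 : ℝ) π, eps1 j x * eps1 k x = if j = k then 1 else 0 := by
  rw [← integral_Ioc_eq_integral_Ioo, ← intervalIntegral.integral_of_le Real.pi_pos.le]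
  have hpi := Real.pi_pos
  have e : ∀ x, eps1 j x * eps1 k x = ((if j = 0 then 1 / Real.sqrt π else Real.sqrt (2 / π)) *
      (if k = 0 then 1 / Real.sqrt π else Real.sqrt (2 / π))) *
      (Real.cos (j * x) * Real.cos (k * x)) := by
    intro x; rw [gs_eps1_eq, gs_eps1_eq]; ring
  simp only [e]
  rw [intervalIntegral.integral_const_mul, gs_int_coscos]
  by_cases hjk : j = k
  · subst hjk
    by_cases h0 : j = 0
    · subst h0
      have : (1 / Real.sqrt π) * (1 / Real.sqrt π) = 1 / π := by
        rw [div_mul_div_comm, Real.mul_self_sqrt Real.pi_pos.le, one_mul]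
      simp only [if_true, this]
      simp
    · have h1 : ¬ ((j : ℤ) + j = 0) := by omega
      simp only [if_neg h0, if_neg h1, Real.mul_self_sqrt (show 0 ≤ 2 / π by positivity)]
      simp
  · have h1 : ¬ ((j : ℤ) + k = 0) := by omega
    have h2 : ¬ ((j : ℤ) - k = 0) := by omega
    simp [h1, h2, hjk]

theorem gs_measD (d : ℕ) : MeasurableSet (domD d) := by
  have : domD d = ⋂ i, (fun x : EuclideanSpace ℝ (Fin d) => x i) ⁻¹' Set.Ioo (0 : ℝ) π := by
    ext x; simp [domD]
  rw [this]
  exact MeasurableSet.iInter fun i => measurableSet_Ioo.preimage (by fun_prop)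

theorem gs_orth {d : ℕ} (j k : Fin d → ℕ) :
    ∫ y in domD d, epsk j y * epsk k y = if j = k then 1 else 0 := by
  have hm := PiLp.volume_preserving_toLp (Fin d)
  rw [← hm.setIntegral_preimage_emb (MeasurableEquiv.toLp 2 (Fin d → ℝ)).measurableEmbedding]
  have hs : (WithLp.toLp 2) ⁻¹' (domD d) = Set.pi Set.univ fun _ : Fin d => Set.Ioo (0 : ℝ) π := by
    ext x; simp [domD]
  rw [hs, volume_pi, Measure.restrict_pi_pi]
  simp only [epsk, ← Finset.prod_mul_distrib]
  rw [integral_fintype_prod_eq_prod (fun i t => eps1 (j i) t * eps1 (k i) t)]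
  simp only [gs_orth1]
  rw [Finset.prod_ite_zero]
  simp [funext_iff]

theorem gs_epsk_abs {d : ℕ} (k : Fin d → ℕ) (x : EuclideanSpace ℝ (Fin d)) : |epsk k x| ≤ 1 := by
  rw [epsk, Finset.abs_prod]
  exact Finset.prod_le_one (fun _ _ => abs_nonneg _) fun _ _ => gs_eps1_abs _ _

theorem gs_epsk_cont {d : ℕ} (k : Fin d → ℕ) : Continuous (epsk k) := by
  unfold epsk
  simp only [gs_eps1_eq]
  fun_prop

theorem gs_lam_nonneg {d : ℕ} (k : Fin d → ℕ) : 0 ≤ lam k :=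
  Finset.sum_nonneg fun _ _ => sq_nonneg _

/-- Fourier coefficient -/
def gsHat {d : ℕ} (f : EuclideanSpace ℝ (Fin d) → ℝ) (k : Fin d → ℕ) : ℝ :=
  ∫ y in domD d, f y * epsk k y

theorem gs_bddD (d : ℕ) : Bornology.IsBounded (domD d) := by
  refine (Metric.isBounded_closedBall (x := (0 : EuclideanSpace ℝ (Fin d)))
    (r := Real.sqrt (d * π ^ 2))).subset fun x hx => ?_
  rw [mem_closedBall_zero_iff, EuclideanSpace.norm_eq]
  apply Real.sqrt_le_sqrt
  calc ∑ i, ‖x i‖ ^ 2 ≤ ∑ i : Fin d, π ^ 2 := by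
        refine Finset.sum_le_sum fun i _ => ?_
        have := hx i
        rw [Real.norm_of_nonneg this.1.le]
        exact pow_le_pow_left₀ this.1.le this.2.le 2
    _ = _ := by simp

theorem gs_compD (d : ℕ) : IsCompact (closure (domD d)) := (gs_bddD d).isCompact_closure

theorem gs_finD (d : ℕ) : volume (domD d) ≠ ⊤ := ((gs_bddD d).measure_lt_top).ne

theorem gs_intD {d : ℕ} (f : EuclideanSpace ℝ (Fin d) → ℝ) (hf : ContinuousOn f (closure (domD d))) :
    IntegrableOn f (domD d) :=
  (hf.integrableOn_compact (gs_compD d)).mono_set subset_closure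

theorem gs_int_mul {d : ℕ} (f : EuclideanSpace ℝ (Fin d) → ℝ) (hf : IntegrableOn f (domD d))
    (k : Fin d → ℕ) : IntegrableOn (fun y => f y * epsk k y) (domD d) := by
  refine Integrable.mul_bdd (c := 1) hf (gs_epsk_cont k).aestronglyMeasurable ?_
  exact Filter.Eventually.of_forall fun y => gs_epsk_abs k y

theorem gs_series {d : ℕ} {E : Type*} [NormedAddCommGroup E] [NormedSpace ℝ E] [CompleteSpace E]
    (f : EuclideanSpace ℝ (Fin d) → ℝ) (hf : IntegrableOn f (domD d))
    (w : (Fin d → ℕ) → E) (hw : Summable fun k => ‖w k‖) (x : EuclideanSpace ℝ (Fin d)) :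
    IntegrableOn (fun y => f y • ∑' k, (epsk k x * epsk k y) • w k) (domD d) ∧
    ∫ y in domD d, f y • ∑' k, (epsk k x * epsk k y) • w k
      = ∑' k, (epsk k x * gsHat f k) • w k := by
  have hb : ∀ k y, ‖(epsk k x * epsk k y) • w k‖ ≤ ‖w k‖ := by
    intro k y
    rw [norm_smul, Real.norm_eq_abs, abs_mul]
    exact mul_le_of_le_one_left (norm_nonneg _)
      (mul_le_one₀ (gs_epsk_abs _ _) (abs_nonneg _) (gs_epsk_abs _ _))
  have hcont : Continuous fun y => ∑' k, (epsk k x * epsk k y) • w k :=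
    continuous_tsum (fun k => by have := gs_epsk_cont k; fun_prop) hw hb
  constructor
  · refine Integrable.smul_bdd hf (∑' k, ‖w k‖) hcont.aestronglyMeasurable ?_
    exact Filter.Eventually.of_forall fun y => tsum_of_norm_bounded hw.hasSum (fun k => hb k y)
  · have hsm : ∀ y, f y • ∑' k, (epsk k x * epsk k y) • w k
        = ∑' k, (f y * epsk k y) • (epsk k x • w k) := by
      intro y
      rw [← Summable.tsum_const_smul]
      · refine tsum_congr fun k => ?_
        rw [smul_smul, smul_smul]; congr 1; ring
      · exact Summable.of_norm_bounded hw (fun k => hb k y)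
    simp only [hsm]
    have hh := hasSum_integral_of_summable_integral_norm (μ := volume.restrict (domD d))
      (F := fun k y => (f y * epsk k y) • (epsk k x • w k))
      (fun k => (gs_int_mul f hf k).smul_const _) (by
        refine Summable.of_nonneg_of_le (fun k => integral_nonneg fun _ => norm_nonneg _)
          (fun k => ?_) (hw.mul_left (∫ y in domD d, ‖f y‖))
        rw [← integral_mul_const]
        refine integral_mono_of_nonneg (Filter.Eventually.of_forall fun _ => norm_nonneg _)
          (hf.norm.mul_const _) (Filter.Eventually.of_forall fun y => ?_)
        simp only [norm_smul, norm_mul, Real.norm_eq_abs]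
        calc |f y| * |epsk k y| * (|epsk k x| * ‖w k‖)
            = |f y| * ‖w k‖ * (|epsk k y| * |epsk k x|) := by ring
          _ ≤ |f y| * ‖w k‖ * 1 := by
            refine mul_le_mul_of_nonneg_left ?_ (by positivity)
            exact mul_le_one₀ (gs_epsk_abs _ _) (abs_nonneg _) (gs_epsk_abs _ _)
          _ = _ := mul_one _)
    rw [← hh.tsum_eq]
    refine tsum_congr fun k => ?_
    rw [integral_smul_const, smul_smul, gsHat, mul_comm]

/-- Fourier coefficients of the basis functions -/
theorem gs_hat_epsk {d : ℕ} (j k : Fin d → ℕ) : gsHat (epsk j) k = if j = k then 1 else 0 :=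
  gs_orth j k

theorem gs_epsk_zero {d : ℕ} (x : EuclideanSpace ℝ (Fin d)) :
    epsk (0 : Fin d → ℕ) x = (1 / Real.sqrt π) ^ d := by
  simp [epsk, eps1]

/-- the heat kernel has mass one -/
theorem gs_HR_mass {d : ℕ} (τ : ℝ) (hτ : 0 < τ) (x : EuclideanSpace ℝ (Fin d)) :
    IntegrableOn (fun y => gsHR τ x y) (domD d) ∧ ∫ y in domD d, gsHR τ x y = 1 := by
  have hw : Summable fun k : Fin d → ℕ => ‖Real.exp (-τ * lam k)‖ := by
    refine (gs_summable_lam (d := d) τ (by simpa using hτ)).congr fun k => ?_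
    rw [← Complex.norm_real]; push_cast; rfl
  obtain ⟨h1, h2⟩ := gs_series (fun y => epsk (0 : Fin d → ℕ) y)
    (gs_intD _ (gs_epsk_cont _).continuousOn) (fun k => Real.exp (-τ * lam k)) hw x
  have hc : (1 / Real.sqrt π) ^ d ≠ 0 := by positivity
  simp only [gs_epsk_zero, smul_eq_mul] at h1 h2
  have h3 : (∑' k, epsk k x * gsHat (fun y : EuclideanSpace ℝ (Fin d) => (1 / Real.sqrt π) ^ d) k
      * Real.exp (-τ * lam k)) = (1 / Real.sqrt π) ^ d := by
    rw [tsum_eq_single (0 : Fin d → ℕ)]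
    · have := gs_hat_epsk (0 : Fin d → ℕ) 0
      simp only [funext gs_epsk_zero] at this
      rw [this]
      simp [gs_epsk_zero, lam]
    · intro k hk
      have := gs_hat_epsk (0 : Fin d → ℕ) k
      simp only [funext gs_epsk_zero] at this
      rw [this, if_neg hk.symm]; simp
  rw [h3, integral_const_mul] at h2
  refine ⟨?_, ?_⟩
  · have := h1.const_mul ((1 / Real.sqrt π) ^ d)⁻¹
    refine this.congr (Filter.Eventually.of_forall fun y => ?_)
    simp only [gsHR, smul_eq_mul]
    rw [inv_mul_cancel_left₀ hc]
  · simp only [gsHR, smul_eq_mul]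
    exact mul_left_cancel₀ hc (by rw [h2, mul_one])

theorem gs_P_bound {d : ℕ} (f : EuclideanSpace ℝ (Fin d) → ℝ) (hf : IntegrableOn f (domD d))
    (M : ℝ) (hM : ∀ y ∈ domD d, |f y| ≤ M)
    (z : ℂ) (hz : 0 < z.re) (hz3 : ‖z‖ ≤ 3 * z.re) (x : EuclideanSpace ℝ (Fin d)) :
    ‖∑' k, (epsk k x * gsHat f k) • Complex.exp (-z * (lam k : ℂ))‖ ≤ M * 3 ^ d := by
  rw [← (gs_series f hf _ (gs_summable_lam z hz) x).2]
  obtain ⟨h1, h2⟩ := gs_HR_mass (gsTau z) (gs_tau_pos z hz) x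
  calc _ ≤ ∫ y in domD d, M * 3 ^ d * gsHR (gsTau z) x y := by
        refine norm_integral_le_of_norm_le (h1.const_mul _) ?_
        filter_upwards [ae_restrict_mem (gs_measD d)] with y hy
        rw [norm_smul, mul_assoc]
        exact mul_le_mul (hM y hy) (gs_H_dom z hz hz3 x y) (norm_nonneg _)
          ((abs_nonneg _).trans (hM y hy))
    _ = _ := by rw [integral_const_mul, h2, mul_one]

theorem gs_hat_abs {d : ℕ} (f : EuclideanSpace ℝ (Fin d) → ℝ) (hf : IntegrableOn f (domD d))
    (k : Fin d → ℕ) : |gsHat f k| ≤ ∫ y in domD d, ‖f y‖ := by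
  rw [gsHat, ← Real.norm_eq_abs]
  refine norm_integral_le_of_norm_le hf.norm (Filter.Eventually.of_forall fun y => ?_)
  rw [norm_mul]
  exact mul_le_of_le_one_right (norm_nonneg _) (gs_epsk_abs k y)

/-- complex time along the ray -/
def gsZ (t s : ℝ) : ℂ := 2 * (Real.sqrt t : ℂ) * gsω * s + t

theorem gs_Z_re (t s : ℝ) : (gsZ t s).re = 2 * Real.sqrt t * s + t := by
  have : gsZ t s = ((2 * Real.sqrt t * s + t : ℝ) : ℂ)
      + ((4 * Real.sqrt t * s : ℝ) : ℂ) * Complex.I := by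
    rw [gsZ, gsω]; push_cast; ring
  rw [this]; simp only [Complex.add_re, Complex.ofReal_re, Complex.re_ofReal_mul, Complex.I_re,
    mul_zero, add_zero]

theorem gs_Z_im (t s : ℝ) : (gsZ t s).im = 4 * Real.sqrt t * s := by
  have : gsZ t s = ((2 * Real.sqrt t * s + t : ℝ) : ℂ)
      + ((4 * Real.sqrt t * s : ℝ) : ℂ) * Complex.I := by
    rw [gsZ, gsω]; push_cast; ring
  rw [this]; simp only [Complex.add_im, Complex.ofReal_im, Complex.im_ofReal_mul, Complex.I_im,
    mul_one, zero_add]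

theorem gs_Z_norm (t s : ℝ) (ht : 0 < t) (hs : 0 < s) : ‖gsZ t s‖ ≤ 3 * (gsZ t s).re := by
  refine (Complex.norm_le_abs_re_add_abs_im _).trans ?_
  have h : 0 ≤ Real.sqrt t * s := by positivity
  rw [gs_Z_re, gs_Z_im, abs_of_nonneg (by linarith), abs_of_nonneg (by linarith)]
  linarith

theorem gs_E_split (t l s : ℝ) :
    gsE 0 s * Complex.exp (-gsZ t s * l)
      = gsE (2 * Real.sqrt t * l) s * (Real.exp (-(t * l)) : ℂ) := by
  rw [gsE, gsE, Complex.ofReal_exp, ← Complex.exp_add, ← Complex.exp_add, gsZ]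
  congr 1
  push_cast
  ring

theorem gs_I_weight (t l : ℝ) (ht : 0 < t) :
    (∫ s in Set.Ioi (0 : ℝ), gsω * gsE 0 s * Complex.exp (-gsZ t s * l)).im
      = (gsI 0).im * Real.exp (-(l ^ 2 + l) * t) := by
  have : ∀ s : ℝ, gsω * gsE 0 s * Complex.exp (-gsZ t s * l)
      = (Real.exp (-(t * l)) : ℂ) * (gsω * gsE (2 * Real.sqrt t * l) s) := by
    intro s; rw [mul_assoc, gs_E_split]; ring
  simp only [this]
  rw [integral_const_mul, Complex.im_ofReal_mul]
  change _ * (gsI _).im = _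
  rw [gs_I_im, mul_left_comm, ← Real.exp_add]
  congr 2
  have : Real.sqrt t ^ 2 = t := Real.sq_sqrt ht.le
  rw [mul_pow, mul_pow, this]; ring

/-- the weights -/
def gsW {d : ℕ} (t : ℝ) (k : Fin d → ℕ) : ℝ := Real.exp (-(lam k ^ 2 + lam k) * t)

theorem gs_sum_exp {d : ℕ} (t : ℝ) (ht : 0 < t) :
    Summable fun k : Fin d → ℕ => Real.exp (-(t * lam k)) := by
  refine (gs_summable_lam (d := d) t (by simpa using ht)).congr fun k => ?_
  rw [← Real.norm_of_nonneg (Real.exp_pos (-(t * lam k))).le, ← Complex.norm_real]; push_cast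
  congr 2; ring

theorem gs_sum_W {d : ℕ} (t : ℝ) (ht : 0 < t) :
    Summable fun k : Fin d → ℕ => ‖gsW t k‖ := by
  refine Summable.of_nonneg_of_le (fun _ => norm_nonneg _) (fun k => ?_) (gs_sum_exp t ht)
  rw [gsW, Real.norm_of_nonneg (Real.exp_pos _).le]
  apply Real.exp_le_exp.2
  nlinarith [mul_nonneg (sq_nonneg (lam k)) ht.le]

/-- the constant -/
def gsK : ℝ := ∫ s in Set.Ioi (0 : ℝ), ‖gsω * gsE 0 s‖

theorem gs_K_nonneg : 0 ≤ gsK := integral_nonneg fun _ => norm_nonneg _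

theorem gs_S_bound {d : ℕ} (f : EuclideanSpace ℝ (Fin d) → ℝ) (hf : IntegrableOn f (domD d))
    (M : ℝ) (hM : ∀ y ∈ domD d, |f y| ≤ M) (t : ℝ) (ht : 0 < t)
    (x : EuclideanSpace ℝ (Fin d)) :
    |(gsI 0).im| * |∑' k, (epsk k x * gsHat f k) • gsW t k| ≤ M * 3 ^ d * gsK := by
  have hi : IntegrableOn (fun s => gsω * gsE 0 s) (Set.Ioi 0) :=
    ((gs_intE 0).const_mul gsω).integrableOn
  have hZc : Continuous (gsZ t) := by unfold gsZ; fun_prop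
  have hEc := gs_contE 0
  have hexp : ∀ (k : Fin d → ℕ) (s : ℝ), 0 < s →
      ‖Complex.exp (-gsZ t s * (lam k : ℂ))‖ ≤ Real.exp (-(t * lam k)) := by
    intro k s hs
    rw [Complex.norm_exp, Complex.re_mul_ofReal, Complex.neg_re, gs_Z_re]
    apply Real.exp_le_exp.2
    have h1 : 0 ≤ Real.sqrt t * s := by positivity
    nlinarith [mul_nonneg h1 (gs_lam_nonneg k)]
  set A := ∫ y in domD d, ‖f y‖ with hA
  have hA0 : 0 ≤ A := integral_nonneg fun _ => norm_nonneg _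
  have ha : ∀ k, |epsk k x * gsHat f k| ≤ A := by
    intro k
    rw [abs_mul]
    exact (mul_le_of_le_one_left (abs_nonneg _) (gs_epsk_abs k x)).trans (gs_hat_abs f hf k)
  have hFb : ∀ k s, 0 < s → ‖(epsk k x * gsHat f k) •
      (gsω * gsE 0 s * Complex.exp (-gsZ t s * (lam k : ℂ)))‖
        ≤ ‖gsω * gsE 0 s‖ * (A * Real.exp (-(t * lam k))) := by
    intro k s hs
    rw [norm_smul, norm_mul (gsω * gsE 0 s), Real.norm_eq_abs]
    have := mul_le_mul (ha k) (hexp k s hs) (norm_nonneg _) hA0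
    calc _ = ‖gsω * gsE 0 s‖ * (|epsk k x * gsHat f k| *
          ‖Complex.exp (-gsZ t s * (lam k : ℂ))‖) := by ring
      _ ≤ _ := mul_le_mul_of_nonneg_left this (norm_nonneg _)
  have hFi : ∀ k, Integrable (fun s => (epsk k x * gsHat f k) •
      (gsω * gsE 0 s * Complex.exp (-gsZ t s * (lam k : ℂ)))) (volume.restrict (Set.Ioi 0)) := by
    intro k
    refine Integrable.mono' (hi.norm.mul_const (A * Real.exp (-(t * lam k)))) 
      (Continuous.aestronglyMeasurable (by fun_prop)) ?_
    filter_upwards [ae_restrict_mem measurableSet_Ioi] with s hs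
    exact hFb k s hs
  have hh := hasSum_integral_of_summable_integral_norm hFi (by
    refine Summable.of_nonneg_of_le (fun k => integral_nonneg fun _ => norm_nonneg _)
      (fun k => ?_) ((gs_sum_exp t ht).mul_left (gsK * A))
    rw [mul_assoc, gsK, ← integral_mul_const]
    refine integral_mono_ae (hFi k).norm (hi.norm.mul_const _) ?_
    filter_upwards [ae_restrict_mem measurableSet_Ioi] with s hs
    exact hFb k s hs)
  have him := (Complex.imCLM.hasSum hh).tsum_eq
  simp only [Complex.imCLM_apply, integral_smul, Complex.smul_im, gs_I_weight t _ ht] at him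
  have e : ∑' k, (epsk k x * gsHat f k) • ((gsI 0).im * Real.exp (-(lam k ^ 2 + lam k) * t))
      = (gsI 0).im * ∑' k, (epsk k x * gsHat f k) • gsW t k := by
    rw [← tsum_mul_left]
    refine tsum_congr fun k => ?_
    simp only [smul_eq_mul, gsW]; ring
  rw [e] at him
  rw [← abs_mul, him]
  refine (Complex.abs_im_le_norm _).trans ?_
  rw [gsK, ← integral_const_mul]
  refine norm_integral_le_of_norm_le (hi.norm.const_mul _) ?_
  filter_upwards [ae_restrict_mem measurableSet_Ioi] with s hs
  have hs0 : (0 : ℝ) < s := hs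
  have hre : 0 < (gsZ t s).re := by rw [gs_Z_re]; positivity
  have hb := gs_P_bound f hf M hM (gsZ t s) hre (gs_Z_norm t s ht hs0) x
  have e2 : ∑' k, (epsk k x * gsHat f k) • (gsω * gsE 0 s * Complex.exp (-gsZ t s * (lam k : ℂ)))
      = gsω * gsE 0 s * ∑' k, (epsk k x * gsHat f k) • Complex.exp (-gsZ t s * (lam k : ℂ)) := by
    rw [← tsum_mul_left]
    refine tsum_congr fun k => ?_
    rw [mul_smul_comm]
  rw [e2, norm_mul, mul_comm]
  exact mul_le_mul_of_nonneg_right hb (norm_nonneg _)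

theorem gs_semi_pos {d : ℕ} (f : EuclideanSpace ℝ (Fin d) → ℝ) (t : ℝ) (ht : 0 < t)
    (x : EuclideanSpace ℝ (Fin d)) :
    greenSemigroup f t x = ∫ y in domD d, f y • ∑' k, (epsk k x * epsk k y) • gsW t k := by
  rw [greenSemigroup, if_neg ht.ne']
  congr 1
  ext y
  rw [smul_eq_mul, green]
  congr 1
  refine tsum_congr fun k => ?_
  rw [smul_eq_mul, gsW]; ring

theorem gs_semi_bound {d : ℕ} (f : EuclideanSpace ℝ (Fin d) → ℝ)
    (hf : ContinuousOn f (closure (domD d)))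
    (M : ℝ) (hM : ∀ y ∈ closure (domD d), |f y| ≤ M) (t : ℝ) (ht : 0 ≤ t)
    (x : EuclideanSpace ℝ (Fin d)) (hx : x ∈ closure (domD d)) :
    |greenSemigroup f t x| ≤ M * (1 + 3 ^ d * gsK / |(gsI 0).im|) := by
  have hM0 : 0 ≤ M := (abs_nonneg _).trans (hM x hx)
  have hc : 0 < |(gsI 0).im| := abs_pos.2 gs_I_ne
  have hK := gs_K_nonneg
  rcases ht.eq_or_lt with h | h
  · rw [greenSemigroup, if_pos h.symm]
    have : 0 ≤ M * (3 ^ d * gsK / |(gsI 0).im|) := by positivity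
    have := hM x hx
    linarith
  · have hi := gs_intD f hf
    rw [gs_semi_pos f t h, (gs_series f hi _ (gs_sum_W t h) x).2]
    have := gs_S_bound f hi M (fun y hy => hM y (subset_closure hy)) t h x
    rw [mul_comm, ← le_div_iff₀ hc] at this
    refine this.trans ?_
    rw [mul_add, mul_assoc, mul_div_assoc]
    linarith

theorem gs_semi_sub {d : ℕ} (f g : EuclideanSpace ℝ (Fin d) → ℝ)
    (hf : ContinuousOn f (closure (domD d))) (hg : ContinuousOn g (closure (domD d)))
    (t : ℝ) (ht : 0 ≤ t) (x : EuclideanSpace ℝ (Fin d)) :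
    greenSemigroup (fun y => f y - g y) t x = greenSemigroup f t x - greenSemigroup g t x := by
  rcases ht.eq_or_lt with h | h
  · simp [greenSemigroup, h.symm]
  · rw [gs_semi_pos _ t h, gs_semi_pos _ t h, gs_semi_pos _ t h, ← integral_sub
      (gs_series f (gs_intD f hf) _ (gs_sum_W t h) x).1
      (gs_series g (gs_intD g hg) _ (gs_sum_W t h) x).1]
    simp only [sub_smul]

theorem gs_semi_poly {d : ℕ} (s : Finset (Fin d → ℕ)) (c : (Fin d → ℕ) → ℝ)
    (t : ℝ) (ht : 0 ≤ t) (x : EuclideanSpace ℝ (Fin d)) :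
    greenSemigroup (fun y => ∑ j ∈ s, c j * epsk j y) t x = ∑ j ∈ s, c j * (gsW t j * epsk j x) := by
  rcases ht.eq_or_lt with h | h
  · simp [greenSemigroup, h.symm, gsW]
  · rw [gs_semi_pos _ t h]
    simp only [Finset.sum_smul, mul_smul]
    have hs := fun j : Fin d → ℕ => gs_series (epsk j)
      (gs_intD _ (gs_epsk_cont j).continuousOn) _ (gs_sum_W t h) x
    simp only [mul_smul] at hs
    rw [integral_finsetSum]
    · refine Finset.sum_congr rfl fun j _ => ?_
      rw [integral_smul, (hs j).2, tsum_eq_single j]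
      · rw [gs_hat_epsk, if_pos rfl]
        simp only [smul_eq_mul]; ring
      · intro k hk
        rw [gs_hat_epsk, if_neg hk.symm]; simp
    · intro j _
      exact (hs j).1.smul (c j)

/-- continuous version of the basis functions on the closure -/
def gsEk {d : ℕ} (k : Fin d → ℕ) : C(closure (domD d), ℝ) :=
  ⟨fun x => epsk k x, (gs_epsk_cont k).comp continuous_subtype_val⟩

/-- cosine of a coordinate -/
def gsCos {d : ℕ} (i : Fin d) : C(closure (domD d), ℝ) :=
  ⟨fun x => Real.cos ((x : EuclideanSpace ℝ (Fin d)) i), by fun_prop⟩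

/-- unnormalized product of cosines -/
def gsCk {d : ℕ} (k : Fin d → ℕ) : C(closure (domD d), ℝ) :=
  ⟨fun x => ∏ i, Real.cos (k i * (x : EuclideanSpace ℝ (Fin d)) i), by fun_prop⟩

theorem gs_Ck_mem {d : ℕ} (k : Fin d → ℕ) :
    (gsCk k : C(closure (domD d), ℝ)) ∈ Submodule.span ℝ (Set.range (gsEk (d := d))) := by
  set N : ℝ := ∏ i, (if k i = 0 then 1 / Real.sqrt π else Real.sqrt (2 / π)) with hN
  have hpi := Real.pi_pos
  have hN0 : N ≠ 0 := by
    refine Finset.prod_ne_zero_iff.2 fun i _ => ?_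
    split_ifs <;> positivity
  have : (gsCk k : C(closure (domD d), ℝ)) = N⁻¹ • gsEk k := by
    ext x
    simp only [gsCk, gsEk, ContinuousMap.coe_mk, ContinuousMap.coe_smul, Pi.smul_apply,
      smul_eq_mul, epsk, gs_eps1_eq, Finset.prod_mul_distrib]
    rw [inv_mul_cancel_left₀ hN0]
  rw [this]
  exact Submodule.smul_mem _ _ (Submodule.subset_span ⟨k, rfl⟩)

theorem gs_cos_mul {d : ℕ} (i : Fin d) (k : Fin d → ℕ) :
    (gsCos i * gsCk k : C(closure (domD d), ℝ)) ∈ Submodule.span ℝ (Set.range (gsCk (d := d))) := by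
  have hupd : ∀ (m : ℕ) (x : closure (domD d)), gsCk (Function.update k i m) x
      = Real.cos (m * (x : EuclideanSpace ℝ (Fin d)) i) *
        ∏ j ∈ Finset.univ.erase i, Real.cos (k j * (x : EuclideanSpace ℝ (Fin d)) j) := by
    intro m x
    simp only [gsCk, ContinuousMap.coe_mk]
    rw [← Finset.mul_prod_erase _ _ (Finset.mem_univ i), Function.update_self]
    congr 1
    refine Finset.prod_congr rfl fun j hj => ?_
    rw [Function.update_of_ne (Finset.ne_of_mem_erase hj)]
  have hself : ∀ x : closure (domD d), gsCk k x
      = Real.cos (k i * (x : EuclideanSpace ℝ (Fin d)) i) *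
        ∏ j ∈ Finset.univ.erase i, Real.cos (k j * (x : EuclideanSpace ℝ (Fin d)) j) := by
    intro x
    rw [← hupd, Function.update_eq_self]
  rcases Nat.eq_zero_or_pos (k i) with h0 | hpos
  · have : (gsCos i * gsCk k : C(closure (domD d), ℝ)) = gsCk (Function.update k i 1) := by
      ext x
      rw [ContinuousMap.mul_apply, hupd, hself, h0]
      simp [gsCos]
    rw [this]
    exact Submodule.subset_span ⟨_, rfl⟩
  · obtain ⟨m, hm⟩ : ∃ m, k i = m + 1 := ⟨k i - 1, by omega⟩
    have : (gsCos i * gsCk k : C(closure (domD d), ℝ))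
        = (1 / 2 : ℝ) • (gsCk (Function.update k i (m + 2)) + gsCk (Function.update k i m)) := by
      ext x
      rw [ContinuousMap.mul_apply, ContinuousMap.smul_apply, ContinuousMap.add_apply, hupd, hupd,
        hself, hm]
      simp only [gsCos, ContinuousMap.coe_mk, smul_eq_mul]
      set a := (x : EuclideanSpace ℝ (Fin d)) i
      have e1 : ((m + 2 : ℕ) : ℝ) * a = ((m + 1 : ℕ) : ℝ) * a + a := by push_cast; ring
      have e2 : (m : ℝ) * a = ((m + 1 : ℕ) : ℝ) * a - a := by push_cast; ring
      rw [e1, e2, Real.cos_add, Real.cos_sub]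
      ring
    rw [this]
    exact Submodule.smul_mem _ _ (Submodule.add_mem _ (Submodule.subset_span ⟨_, rfl⟩)
      (Submodule.subset_span ⟨_, rfl⟩))

theorem gs_adjoin {d : ℕ} (g : C(closure (domD d), ℝ))
    (hg : g ∈ Algebra.adjoin ℝ (Set.range (gsCos (d := d)))) :
    g ∈ Submodule.span ℝ (Set.range (gsEk (d := d))) := by
  have h1 : Submodule.span ℝ (Set.range (gsCk (d := d)))
      ≤ Submodule.span ℝ (Set.range (gsEk (d := d))) := by
    rw [Submodule.span_le]
    rintro _ ⟨k, rfl⟩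
    exact gs_Ck_mem k
  apply h1
  rw [← Subalgebra.mem_toSubmodule, Algebra.adjoin_eq_span] at hg
  refine (Submodule.span_le.2 ?_) hg
  intro m hm
  induction hm using Submonoid.closure_induction_left with
  | one =>
    refine Submodule.subset_span ⟨0, ?_⟩
    ext x
    simp [gsCk]
  | mul_left x hx y _ ih =>
    obtain ⟨i, rfl⟩ := hx
    have : Submodule.span ℝ (Set.range (gsCk (d := d))) ≤
        (Submodule.span ℝ (Set.range (gsCk (d := d)))).comap
          (LinearMap.mulLeft ℝ (gsCos i : C(closure (domD d), ℝ))) := by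
      rw [Submodule.span_le]
      rintro _ ⟨k, rfl⟩
      exact gs_cos_mul i k
    exact this ih

theorem gs_closure_Icc {d : ℕ} (x : EuclideanSpace ℝ (Fin d)) (hx : x ∈ closure (domD d))
    (i : Fin d) : x i ∈ Set.Icc (0 : ℝ) π := by
  have hc : IsClosed ((fun x : EuclideanSpace ℝ (Fin d) => x i) ⁻¹' Set.Icc (0 : ℝ) π) :=
    isClosed_Icc.preimage (by fun_prop)
  have hsub : domD d ⊆ (fun x : EuclideanSpace ℝ (Fin d) => x i) ⁻¹' Set.Icc (0 : ℝ) π :=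
    fun y hy => Set.Ioo_subset_Icc_self (hy i)
  exact closure_minimal hsub hc hx

theorem gs_approx {d : ℕ} (u : EuclideanSpace ℝ (Fin d) → ℝ)
    (hu : ContinuousOn u (closure (domD d))) (ε : ℝ) (hε : 0 < ε) :
    ∃ (s : Finset (Fin d → ℕ)) (c : (Fin d → ℕ) → ℝ), ∀ x ∈ closure (domD d),
      |u x - ∑ j ∈ s, c j * epsk j x| < ε := by
  have : CompactSpace (closure (domD d)) := isCompact_iff_compactSpace.1 (gs_compD d)
  have hsep : (Algebra.adjoin ℝ (Set.range (gsCos (d := d)))).SeparatesPoints := by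
    intro x y hxy
    have : ∃ i, (x : EuclideanSpace ℝ (Fin d)) i ≠ (y : EuclideanSpace ℝ (Fin d)) i := by
      by_contra h
      push Not at h
      exact hxy (Subtype.ext (PiLp.ext h))
    obtain ⟨i, hi⟩ := this
    refine ⟨gsCos i, ⟨gsCos i, Algebra.subset_adjoin ⟨i, rfl⟩, rfl⟩, fun h => hi ?_⟩
    exact Real.injOn_cos (gs_closure_Icc _ x.2 i) (gs_closure_Icc _ y.2 i) h
  obtain ⟨g, hg⟩ := ContinuousMap.exists_mem_subalgebra_near_continuousMap_of_separatesPoints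
    _ hsep ⟨fun x => u x, hu.domRestrict⟩ ε hε
  obtain ⟨c, hc⟩ := Finsupp.mem_span_range_iff_exists_finsupp.1 (gs_adjoin _ g.2)
  refine ⟨c.support, c, fun x hx => ?_⟩
  have h1 := (ContinuousMap.norm_coe_le_norm _ (⟨x, hx⟩ : closure (domD d))).trans_lt hg
  rw [← hc] at h1
  rw [abs_sub_comm]
  simp [Finsupp.sum, gsEk, ContinuousMap.sum_apply] at h1
  exact h1
/-- If `u₀` is continuous on the closure of `D`, then `(x,t) ↦ G_t u₀(x)` is continuous
on `closure(D) × [0,T]` for every `T > 0`. -/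
theorem statement17 (d : ℕ) (hd : d = 1 ∨ d = 2 ∨ d = 3)
    (u₀ : EuclideanSpace ℝ (Fin d) → ℝ) (hu₀ : ContinuousOn u₀ (closure (domD d))) :
    ∀ T : ℝ, 0 < T →
      ContinuousOn (fun p : EuclideanSpace ℝ (Fin d) × ℝ => greenSemigroup u₀ p.2 p.1)
        (closure (domD d) ×ˢ Set.Icc (0 : ℝ) T) := by
  intro T _
  set B : ℝ := 1 + 3 ^ d * gsK / |(gsI 0).im| with hB
  have hK := gs_K_nonneg
  have hB0 : 0 < B := by positivity
  refine continuousOn_of_uniform_approx_of_continuousOn fun U hU => ?_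
  obtain ⟨ε, hε, hεU⟩ := Metric.mem_uniformity_dist.1 hU
  obtain ⟨s, c, hsc⟩ := gs_approx u₀ hu₀ (ε / (2 * B)) (by positivity)
  have hp : Continuous fun y : EuclideanSpace ℝ (Fin d) => ∑ j ∈ s, c j * epsk j y :=
    continuous_finsetSum _ fun j _ => (gs_epsk_cont j).const_mul (c j)
  refine ⟨fun p => greenSemigroup (fun y => ∑ j ∈ s, c j * epsk j y) p.2 p.1, ?_, ?_⟩
  · have hcont : Continuous fun p : EuclideanSpace ℝ (Fin d) × ℝ =>
        ∑ j ∈ s, c j * (gsW p.2 j * epsk j p.1) := by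
      refine continuous_finsetSum _ fun j _ => ?_
      have := gs_epsk_cont j
      unfold gsW
      fun_prop
    refine hcont.continuousOn.congr fun p hp => ?_
    exact gs_semi_poly s c p.2 hp.2.1 p.1
  · intro p hpm
    apply hεU
    rw [Real.dist_eq, ← gs_semi_sub u₀ _ hu₀ hp.continuousOn p.2 hpm.2.1 p.1]
    refine (gs_semi_bound _ (hu₀.sub hp.continuousOn) (ε / (2 * B))
      (fun y hy => (hsc y hy).le) p.2 hpm.2.1 p.1 hpm.1).trans_lt ?_
    rw [← hB]
    have : ε / (2 * B) * B = ε / 2 := by field_simp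
    rw [this]; linarith
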